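/- arXiv:2505.19382 — 2 statements merged into one kernel-verified Lean document; each statement's English description precedes it below -/
import Mathlib

section
/- With the finite-sum setup (𝒮 finite nonempty, F(·,ξ) continuously differentiable, f the average, g_S the subsample-average gradient, c continuously differentiable, and KKT residuals T and T_S as defined), let (x_k)_{k≥0}, (λ_k)_{k≥0}, γ_k ∈ [0, γ] with γ < 1, ω ≥ 0, β ∈ (0,1), and for k ≥ 1 let S_k ⊆ 𝒮 be any subset with |S_k| = ⌈(1 − β^k)|𝒮|⌉ and ε_k = ω (1 − |S_k|/|𝒮|). Assume: (i) ‖T_{S_k}(x_k, λ_k)‖ ≤ γ_k ‖T_{S_k}(x_{k−1}, λ_{k−1})‖ + ε_k for all k ≥ 1; (ii) ‖∇F(x, ξ)‖² ≤ ω₁² ‖∇f(x)‖² + ω₂² for all x ∈ ℝⁿ, ξ ∈ 𝒮; (iii) ‖∇f(x_k)‖ ≤ κ_g for all k ≥ 0; (iv) ν > 0 satisfies γ + ν < 1. Then for all k ≥ 0, ‖T(x_k, λ_k)‖ ≤ (max{γ + ν, β})^k · max{‖T(x₀, λ₀)‖, a₂/ν}, where a₂ = ω + 2(1 + γ)(ω₁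 κ_g + ω₂). -/
/-- Finite-sum objective: `f(x) = (1/|𝒮|) Σ_{ξ∈𝒮} F(x, ξ)`. -/
noncomputable def favg {n : ℕ} {ι : Type*} [Fintype ι]
    (F : ι → EuclideanSpace ℝ (Fin n) → ℝ) (x : EuclideanSpace ℝ (Fin n)) : ℝ :=
  (1 / (Fintype.card ι : ℝ)) * ∑ ξ, F ξ x

/-- Subsampled gradient: `g_S(x) = (1/|S|) Σ_{ξ∈S} ∇F(x, ξ)`. -/
noncomputable def gsub {n : ℕ} {ι : Type*}
    (F : ι → EuclideanSpace ℝ (Fin n) → ℝ) (S : Finset ι)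
    (x : EuclideanSpace ℝ (Fin n)) : EuclideanSpace ℝ (Fin n) :=
  (1 / (S.card : ℝ)) • ∑ ξ ∈ S, gradient (F ξ) x

/-- Euclidean norm of the KKT residual `(g + Σ λᵢ ∇cᵢ(x), c(x))`. -/
noncomputable def kktNorm {n m : ℕ} (g : EuclideanSpace ℝ (Fin n))
    (c : EuclideanSpace ℝ (Fin n) → EuclideanSpace ℝ (Fin m))
    (x : EuclideanSpace ℝ (Fin n)) (lam : EuclideanSpace ℝ (Fin m)) : ℝ :=
  Real.sqrt (‖g + ∑ i, lam i • gradient (fun y => c y i) x‖ ^ 2 + ‖c x‖ ^ 2)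

theorem gradient_favg {n : ℕ} {ι : Type*} [Fintype ι]
    {F : ι → EuclideanSpace ℝ (Fin n) → ℝ} {x : EuclideanSpace ℝ (Fin n)}
    (hF : ∀ ξ, DifferentiableAt ℝ (F ξ) x) :
    gradient (favg F) x = (1 / (Fintype.card ι : ℝ)) • ∑ ξ, gradient (F ξ) x := by
  have h : HasFDerivAt (favg F) ((1 / (Fintype.card ι : ℝ)) • ∑ ξ, fderiv ℝ (F ξ) x) x :=
    (HasFDerivAt.fun_sum fun ξ _ => (hF ξ).hasFDerivAt).const_mul _
  simp only [gradient, h.fderiv, map_smulₛₗ, map_sum, conj_trivial]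

theorem norm_average_sub_average_le {ι E : Type*} [Fintype ι] [NormedAddCommGroup E]
    [NormedSpace ℝ E] {S : Finset ι} (hS : S.Nonempty) {v : ι → E} {B : ℝ}
    (hv : ∀ ξ, ‖v ξ‖ ≤ B) :
    ‖(1 / (Fintype.card ι : ℝ)) • ∑ ξ, v ξ - (1 / (S.card : ℝ)) • ∑ ξ ∈ S, v ξ‖
      ≤ 2 * (1 - (S.card : ℝ) / Fintype.card ι) * B := by
  classical
  have hs : (0 : ℝ) < S.card := by exact_mod_cast hS.card_pos
  have hsN : (S.card : ℝ) ≤ Fintype.card ι := by exact_mod_cast S.card_le_univ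
  have hN : (0 : ℝ) < Fintype.card ι := hs.trans_le hsN
  have hdiff : 0 ≤ 1 / (S.card : ℝ) - 1 / Fintype.card ι :=
    sub_nonneg.2 (one_div_le_one_div_of_le hs hsN)
  have hin : ‖∑ ξ ∈ S, v ξ‖ ≤ S.card * B := by
    simpa using norm_sum_le_of_le S fun ξ _ => hv ξ
  have hout : ‖∑ ξ ∈ Sᶜ, v ξ‖ ≤ (Fintype.card ι - S.card) * B := by
    have h := norm_sum_le_of_le Sᶜ fun ξ _ => hv ξ
    rwa [Finset.sum_const, nsmul_eq_mul, Finset.card_compl,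
      Nat.cast_sub S.card_le_univ] at h
  have hsplit : (1 / (Fintype.card ι : ℝ)) • ∑ ξ, v ξ - (1 / (S.card : ℝ)) • ∑ ξ ∈ S, v ξ
      = (1 / (Fintype.card ι : ℝ)) • ∑ ξ ∈ Sᶜ, v ξ
        - (1 / (S.card : ℝ) - 1 / Fintype.card ι) • ∑ ξ ∈ S, v ξ := by
    rw [← Finset.sum_add_sum_compl S v]
    module
  rw [hsplit]
  calc _ ≤ ‖(1 / (Fintype.card ι : ℝ)) • ∑ ξ ∈ Sᶜ, v ξ‖
        + ‖(1 / (S.card : ℝ) - 1 / Fintype.card ι) • ∑ ξ ∈ S, v ξ‖ := norm_sub_le _ _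
    _ = 1 / (Fintype.card ι : ℝ) * ‖∑ ξ ∈ Sᶜ, v ξ‖
        + (1 / (S.card : ℝ) - 1 / Fintype.card ι) * ‖∑ ξ ∈ S, v ξ‖ := by
      rw [norm_smul_of_nonneg (by positivity), norm_smul_of_nonneg hdiff]
    _ ≤ 1 / (Fintype.card ι : ℝ) * ((Fintype.card ι - S.card) * B)
        + (1 / (S.card : ℝ) - 1 / Fintype.card ι) * (S.card * B) := by gcongr
    _ = _ := by field_simp; ring

theorem kktNorm_le_add_norm_sub {n m : ℕ} (g g' : EuclideanSpace ℝ (Fin n))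
    (c : EuclideanSpace ℝ (Fin n) → EuclideanSpace ℝ (Fin m))
    (x : EuclideanSpace ℝ (Fin n)) (lam : EuclideanSpace ℝ (Fin m)) :
    kktNorm g c x lam ≤ kktNorm g' c x lam + ‖g - g'‖ := by
  unfold kktNorm
  set w := ∑ i, lam i • gradient (fun y => c y i) x
  have htri : ‖g + w‖ ≤ ‖g' + w‖ + ‖g - g'‖ := by
    have h := norm_add_le (g' + w) (g - g')
    rwa [show g' + w + (g - g') = g + w by abel] at h
  have hsq := Real.sq_sqrt (show 0 ≤ ‖g' + w‖ ^ 2 + ‖c x‖ ^ 2 by positivity)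
  have hle : ‖g' + w‖ ≤ √(‖g' + w‖ ^ 2 + ‖c x‖ ^ 2) :=
    Real.le_sqrt_of_sq_le (le_add_of_nonneg_right (sq_nonneg _))
  refine Real.sqrt_le_iff.2 ⟨by positivity, ?_⟩
  nlinarith [pow_le_pow_left₀ (norm_nonneg _) htri 2,
    mul_le_mul_of_nonneg_right hle (norm_nonneg (g - g'))]

theorem linear_rate_of_geometric_perturbation {R : ℕ → ℝ} {γ ν β a : ℝ} (hγ : 0 ≤ γ)
    (hν : 0 < ν) (hβ0 : 0 ≤ β) (hβ1 : β ≤ 1) (hR : 0 ≤ R 0)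
    (h : ∀ k, R (k + 1) ≤ γ * R k + a * β ^ (k + 1)) (k : ℕ) :
    R k ≤ (max (γ + ν) β) ^ k * max (R 0) (a / ν) := by
  set ρ := max (γ + ν) β
  set M := max (R 0) (a / ν)
  have hM : 0 ≤ M := hR.trans (le_max_left _ _)
  have hρ : 0 ≤ ρ := hβ0.trans (le_max_right _ _)
  have ha : a ≤ ν * M := (div_le_iff₀' hν).1 (le_max_right _ _)
  induction k with
  | zero => rw [pow_zero, one_mul]; exact le_max_left _ _
  | succ k ih =>
    have hpow : β ^ (k + 1) ≤ ρ ^ k :=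
      (pow_le_pow_of_le_one hβ0 hβ1 k.le_succ).trans
        (pow_le_pow_left₀ hβ0 (le_max_right _ _) k)
    calc R (k + 1) ≤ γ * R k + a * β ^ (k + 1) := h k
      _ ≤ γ * (ρ ^ k * M) + ν * M * ρ ^ k := by gcongr
      _ = ρ ^ k * (γ + ν) * M := by ring
      _ ≤ ρ ^ k * ρ * M := by gcongr; exact le_max_left _ _
      _ = ρ ^ (k + 1) * M := by rw [pow_succ]

/-- Corollary 2.1(1): linear convergence of the equality-constrained RA framework
with the prescribed geometrically increasing batch-size sequence (finite-sum case). -/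
theorem ra_equality_finite_sum_geometric_batch_linear_rate
    {n m : ℕ} {ι : Type*} [Fintype ι] [Nonempty ι]
    (F : ι → EuclideanSpace ℝ (Fin n) → ℝ) (hF : ∀ ξ, ContDiff ℝ 1 (F ξ))
    (c : EuclideanSpace ℝ (Fin n) → EuclideanSpace ℝ (Fin m)) (hc : ContDiff ℝ 1 c)
    (x : ℕ → EuclideanSpace ℝ (Fin n)) (lam : ℕ → EuclideanSpace ℝ (Fin m))
    (γk : ℕ → ℝ) (γ : ℝ) (hγk : ∀ k, 0 ≤ γk k ∧ γk k ≤ γ) (hγ : γ < 1)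
    (ω : ℝ) (hω : 0 ≤ ω) (β : ℝ) (hβ0 : 0 < β) (hβ1 : β < 1)
    (S : ℕ → Finset ι)
    -- prescribed batch sizes |S_k| = ⌈(1 − βᵏ)|𝒮|⌉ for k ≥ 1:
    (hScard : ∀ k, ((S (k + 1)).card : ℝ)
      = ⌈(1 - β ^ (k + 1)) * (Fintype.card ι : ℝ)⌉₊)
    -- (i) termination criterion with tolerance ε_k = ω(1 − |S_k|/|𝒮|):
    (hterm : ∀ k,
      kktNorm (gsub F (S (k + 1)) (x (k + 1))) c (x (k + 1)) (lam (k + 1))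
        ≤ γk (k + 1) * kktNorm (gsub F (S (k + 1)) (x k)) c (x k) (lam k)
          + ω * (1 - ((S (k + 1)).card : ℝ) / (Fintype.card ι : ℝ)))
    -- (ii) bounded individual component gradients:
    (ω₁ ω₂ : ℝ) (hω₁ : 0 ≤ ω₁) (hω₂ : 0 ≤ ω₂)
    (hgradbound : ∀ (y : EuclideanSpace ℝ (Fin n)) (ξ : ι),
      ‖gradient (F ξ) y‖ ^ 2 ≤ ω₁ ^ 2 * ‖gradient (favg F) y‖ ^ 2 + ω₂ ^ 2)
    -- (iii) bounded true gradients along the iterates: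
    (κg : ℝ) (hκg : 0 ≤ κg)
    (hbound : ∀ k, ‖gradient (favg F) (x k)‖ ≤ κg)
    -- (iv):
    (ν : ℝ) (hν : 0 < ν) (hν₁ : γ + ν < 1) :
    ∀ k, kktNorm (gradient (favg F) (x k)) c (x k) (lam k)
      ≤ (max (γ + ν) β) ^ k
        * max (kktNorm (gradient (favg F) (x 0)) c (x 0) (lam 0))
            ((ω + 2 * (1 + γ) * (ω₁ * κg + ω₂)) / ν) := by
  have hN : (0 : ℝ) < Fintype.card ι := by exact_mod_cast Fintype.card_pos
  have hγ0 : 0 ≤ γ := (hγk 0).1.trans (hγk 0).2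
  set B := ω₁ * κg + ω₂
  have hB : 0 ≤ B := by positivity
  have herr (j k : ℕ) : ‖gradient (favg F) (x j) - gsub F (S (k + 1)) (x j)‖
      ≤ 2 * (1 - ((S (k + 1)).card : ℝ) / Fintype.card ι) * B := by
    have hS : (S (k + 1)).Nonempty := by
      have hpos : 0 < (1 - β ^ (k + 1)) * (Fintype.card ι : ℝ) :=
        mul_pos (sub_pos.2 (pow_lt_one₀ hβ0.le hβ1 k.succ_ne_zero)) hN
      rw [← Finset.card_pos, Nat.cast_injective (hScard k)]
      exact Nat.ceil_pos.2 hpos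
    rw [gradient_favg fun ξ => (hF ξ).differentiable one_ne_zero _]
    refine norm_average_sub_average_le hS fun ξ => ?_
    have hg := norm_nonneg (gradient (favg F) (x j))
    have h : ‖gradient (F ξ) (x j)‖ ≤ ω₁ * ‖gradient (favg F) (x j)‖ + ω₂ := by
      refine (sq_le_sq₀ (norm_nonneg _) (by positivity)).1 ?_
      nlinarith [hgradbound (x j) ξ, mul_nonneg (mul_nonneg hω₁ hg) hω₂]
    exact h.trans (add_le_add_left (mul_le_mul_of_nonneg_left (hbound j) hω₁) ω₂)
  refine linear_rate_of_geometric_perturbation hγ0 hν hβ0.le hβ1.le (Real.sqrt_nonneg _)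
    fun k => ?_
  have hδ : 1 - ((S (k + 1)).card : ℝ) / Fintype.card ι ≤ β ^ (k + 1) := by
    rw [sub_le_comm, le_div_iff₀ hN, hScard]
    exact Nat.le_ceil _
  set δ := 1 - ((S (k + 1)).card : ℝ) / Fintype.card ι
  have hnew := kktNorm_le_add_norm_sub (gradient (favg F) (x (k + 1)))
    (gsub F (S (k + 1)) (x (k + 1))) c (x (k + 1)) (lam (k + 1))
  have hold := kktNorm_le_add_norm_sub (gsub F (S (k + 1)) (x k))
    (gradient (favg F) (x k)) c (x k) (lam k)
  rw [norm_sub_rev] at hold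
  have hstep : γk (k + 1) * kktNorm (gsub F (S (k + 1)) (x k)) c (x k) (lam k)
      ≤ γ * (kktNorm (gradient (favg F) (x k)) c (x k) (lam k) + 2 * δ * B) :=
    mul_le_mul (hγk _).2 (hold.trans (by gcongr; exact herr k k)) (Real.sqrt_nonneg _) hγ0
  have ha : 0 ≤ ω + 2 * (1 + γ) * B := by positivity
  linarith [hterm k, herr (k + 1) k, mul_le_mul_of_nonneg_left hδ ha]
end

section
/- Let H be a symmetric real n×n matrix, J a real m×n matrix with operator norm ‖J‖ ≤ κ_J, and M = [[H, Jᵀ], [J, 0]] invertible with ‖M⁻¹‖ ≤ 1/κ for some κ > 0 (operator norms induced by Euclidean norms). Let c ∈ ℝᵐ, let (d̂, δ̂) ∈ ℝⁿ × ℝᵐ satisfy J d̂ = −c, and let d ∈ ℝⁿ, δ ∈ ℝᵐ satisfy M (d − d̂, δ − δ̂) = (ρ, r) with ‖ρ‖ ≤ ε_opt ‖c‖ and ‖r‖ ≤ ε_feas ‖c‖, where ε_feas, ε_opt ≥ 0 and κ_J (ε_feas + ε_opt)/κ < 1. Then ‖d − d̂‖ ≤ η_d ‖d̂‖ with η_d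 = κ_J (ε_feas + ε_opt)/κ < 1. -/
open Matrix

/-- Euclidean norm of a finitely indexed real vector. -/
noncomputable def euclNorm {ι : Type*} [Fintype ι] (v : ι → ℝ) : ℝ :=
  Real.sqrt (∑ i, v i ^ 2)

theorem euclNorm_neg {ι : Type*} [Fintype ι] (v : ι → ℝ) : euclNorm (-v) = euclNorm v := by
  simp [euclNorm]

theorem euclNorm_le_euclNorm_sumElim {ι κ : Type*} [Fintype ι] [Fintype κ]
    (u : ι → ℝ) (v : κ → ℝ) : euclNorm u ≤ euclNorm (Sum.elim u v) := by
  apply Real.sqrt_le_sqrt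
  simp only [Fintype.sum_sum_type, Sum.elim_inl, Sum.elim_inr]
  exact le_add_of_nonneg_right (Finset.sum_nonneg fun i _ => sq_nonneg (v i))

theorem euclNorm_sumElim_le {ι κ : Type*} [Fintype ι] [Fintype κ]
    (u : ι → ℝ) (v : κ → ℝ) : euclNorm (Sum.elim u v) ≤ euclNorm u + euclNorm v := by
  simp only [euclNorm, Fintype.sum_sum_type, Sum.elim_inl, Sum.elim_inr]
  have hu : 0 ≤ ∑ i, u i ^ 2 := Finset.sum_nonneg fun i _ => sq_nonneg (u i)
  have hv : 0 ≤ ∑ i, v i ^ 2 := Finset.sum_nonneg fun i _ => sq_nonneg (v i)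
  refine Real.sqrt_le_iff.mpr ⟨by positivity, ?_⟩
  nlinarith [Real.sq_sqrt hu, Real.sq_sqrt hv,
    mul_nonneg (Real.sqrt_nonneg (∑ i, u i ^ 2)) (Real.sqrt_nonneg (∑ i, v i ^ 2))]

/-- Lemma 2.3, second case: relative error of an inexact SQP direction under the
residual conditions `‖ρ‖ ≤ ε_opt ‖c‖`, `‖r‖ ≤ ε_feas ‖c‖`, where the exact direction
satisfies `J d̂ = −c`, `‖J‖ ≤ κ_J`, and the KKT matrix `M = [[H, Jᵀ], [J, 0]]` is
invertible with `‖M⁻¹‖ ≤ 1/κ` (Euclidean operator norms). -/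
theorem inexact_sqp_direction_relative_error_caseII
    {n m : ℕ} (H : Matrix (Fin n) (Fin n) ℝ) (hH : H.IsSymm)
    (J : Matrix (Fin m) (Fin n) ℝ) (κJ : ℝ)
    -- `‖J‖ ≤ κ_J` for the operator norm induced by the Euclidean norms:
    (hJ : ∀ u : Fin n → ℝ, euclNorm (J.mulVec u) ≤ κJ * euclNorm u)
    (M : Matrix (Fin n ⊕ Fin m) (Fin n ⊕ Fin m) ℝ)
    (hM : M = Matrix.fromBlocks H Jᵀ J 0)
    (hMunit : IsUnit M)
    (κ : ℝ) (hκ : 0 < κ)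
    -- `‖M⁻¹‖ ≤ 1/κ` for the operator norm induced by the Euclidean norm:
    (hMinv : ∀ w : Fin n ⊕ Fin m → ℝ, euclNorm (M⁻¹.mulVec w) ≤ (1 / κ) * euclNorm w)
    (cvec : Fin m → ℝ)
    (d dh : Fin n → ℝ) (δ δh : Fin m → ℝ)
    (hfeas : J.mulVec dh = -cvec)
    (ρ : Fin n → ℝ) (r : Fin m → ℝ)
    (heq : M.mulVec (Sum.elim (d - dh) (δ - δh)) = Sum.elim ρ r)
    (εfeas εopt : ℝ) (hεfeas : 0 ≤ εfeas) (hεopt : 0 ≤ εopt)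
    (hρ : euclNorm ρ ≤ εopt * euclNorm cvec)
    (hr : euclNorm r ≤ εfeas * euclNorm cvec)
    (hlt : κJ * (εfeas + εopt) / κ < 1) :
    euclNorm (d - dh) ≤ (κJ * (εfeas + εopt) / κ) * euclNorm dh
      ∧ κJ * (εfeas + εopt) / κ < 1 := by
  refine ⟨?_, hlt⟩
  have hsol : M⁻¹.mulVec (Sum.elim ρ r) = Sum.elim (d - dh) (δ - δh) := by
    rw [← heq, Matrix.mulVec_mulVec,
      Matrix.nonsing_inv_mul M ((Matrix.isUnit_iff_isUnit_det M).mp hMunit), Matrix.one_mulVec]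
  have hc : euclNorm cvec ≤ κJ * euclNorm dh := by
    rw [← euclNorm_neg cvec, ← hfeas]
    exact hJ dh
  calc euclNorm (d - dh)
      ≤ euclNorm (M⁻¹.mulVec (Sum.elim ρ r)) := by
        rw [hsol]
        exact euclNorm_le_euclNorm_sumElim _ _
    _ ≤ (1 / κ) * euclNorm (Sum.elim ρ r) := hMinv _
    _ ≤ (1 / κ) * (euclNorm ρ + euclNorm r) := by
        gcongr
        exact euclNorm_sumElim_le ρ r
    _ ≤ (1 / κ) * (εopt * euclNorm cvec + εfeas * euclNorm cvec) := by gcongr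
    _ ≤ (1 / κ) * (εopt * (κJ * euclNorm dh) + εfeas * (κJ * euclNorm dh)) := by gcongr
    _ = (κJ * (εfeas + εopt) / κ) * euclNorm dh := by ring
end
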